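/- For each natural number k there exist nonnegative integers e_1, d_1, e_2, d_2, ..., e_s, d_s with Σ_i e_i > 50·Σ_i d_i and Σ_i (e_i + d_i) = m_k, and K-linear maps g_{i,k} : H_{d_i} -> H_{d_i}, such that for every monomial w ∈ M_{m_k} written as w = Π_i u_i v_i with u_i ∈ M_{e_i} and v_i ∈ M_{d_i}, one has R_k(w) = Π_i u_i · g_{i,k}(v_i). Moreover, letting σ be the permutation of the m_k letter positions with (Π_i u_i v_i)^σ = (Π_i u_i)(Π_i v_i) for all such u_i, v_i (acting on monomials of degree m_k by permuting letter positions, extended K-linearly to H_{m_k}), and defining T_k(h) = (R_k(h^{σ^{-1}}))^σ, one has T_k(uv) = u·f_k(v) for u = Π_i u_i and v = Π_i v_i, where f_k is the K-linear map defined on products by f_k(Π_i v_i) = Π_i g_{i,k}(v_i). -/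

import Mathlib

open scoped Classical BigOperators

noncomputable section

/-- The free associative unital `K`-algebra on six generators `x1 x2 x3 y1 y2 y3`,
realized as the monoid algebra of the free monoid on six letters. -/
abbrev FreeA (K : Type) [Field K] : Type := MonoidAlgebra K (FreeMonoid (Fin 6))

/-- The map sending the generators `x1 x2 x3` to `x` and `y1 y2 y3` to `y`. -/
def bf : Fin 6 → Fin 2 := fun i => if (i : ℕ) < 3 then 0 else 1

/-- The monoid homomorphism `β` from monomials in six letters to monomials in two letters. -/
def bm : FreeMonoid (Fin 6) →* FreeMonoid (Fin 2) := FreeMonoid.map bf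

/-- Degree (length) of a monomial. -/
def len {α : Type} (w : FreeMonoid α) : ℕ := (FreeMonoid.toList w).length

/-- The ordering `≺` on monomials in `x, y`: same degree and lexicographically smaller. -/
def prec (z z' : FreeMonoid (Fin 2)) : Prop :=
  len z = len z' ∧ List.Lex (· < ·) (FreeMonoid.toList z) (FreeMonoid.toList z')

/-- The finite set of monomials of degree `n` in six letters. -/
def wordsOf (n : ℕ) : Finset (FreeMonoid (Fin 6)) :=
  (Finset.univ : Finset (Fin n → Fin 6)).image fun f => FreeMonoid.ofList (List.ofFn f)

/-- `wComp K z n` is `z(n₁,…,n₆)`: the sum of all monomials `v` (in six letters) with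
`β v = z` and with exactly `nᵢ` occurrences of the `i`-th generator; it is `0` if no such
monomial exists (in particular if some `nᵢ` is negative). -/
def wComp (K : Type) [Field K] (z : FreeMonoid (Fin 2)) (n : Fin 6 → ℤ) : FreeA K :=
  ∑ v ∈ (wordsOf (len z)).filter
      (fun v => bm v = z ∧ ∀ e : Fin 6, ((FreeMonoid.toList v).count e : ℤ) = n e),
    MonoidAlgebra.single v 1

/-- `H_i`: the `K`-span of the monomials of degree `i`. -/
def Hgr (K : Type) [Field K] (i : ℕ) : Submodule K (FreeA K) :=
  Submodule.span K {a | ∃ w : FreeMonoid (Fin 6), len w = i ∧ a = MonoidAlgebra.single w (1 : K)}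

/-- `S(z)` for `z` a monomial in `x, y`: the span of the monomials `w` in six letters of the
same degree with `β w ≺ z`.  (For a monomial `z` in six letters, `S(z) = SP K (bm z)`.) -/
def SP (K : Type) [Field K] (z : FreeMonoid (Fin 2)) : Submodule K (FreeA K) :=
  Submodule.span K
    {a | ∃ w : FreeMonoid (Fin 6), len w = len z ∧ prec (bm w) z ∧
      a = MonoidAlgebra.single w (1 : K)}

/-- `Q(z)`: the span of the monomials `w` of the same degree with `β w = z`. -/
def QP (K : Type) [Field K] (z : FreeMonoid (Fin 2)) : Submodule K (FreeA K) :=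
  Submodule.span K
    {a | ∃ w : FreeMonoid (Fin 6), len w = len z ∧ bm w = z ∧
      a = MonoidAlgebra.single w (1 : K)}

end

noncomputable section

/-- The monomial of degree `n` given by a function on positions. -/
def wordOfFn {n : ℕ} (f : Fin n → Fin 6) : FreeMonoid (Fin 6) :=
  FreeMonoid.ofList (List.ofFn f)

end

section Splitting

variable {K : Type} [Field K]

lemma len_mul {α : Type} (u v : FreeMonoid α) : len (u * v) = len u + len v := by
  simp [len]

lemma len_prod_ofFn {α : Type} {s : ℕ} (f : Fin s → FreeMonoid α) :
    len (List.ofFn f).prod = ∑ i, len (f i) := by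
  induction s with
  | zero => simp [len]
  | succ s ih => simp [List.ofFn_succ, len_mul, ih, Fin.sum_univ_succ]

lemma single_mem_Hgr {n : ℕ} {w : FreeMonoid (Fin 6)} (hw : len w = n) :
    MonoidAlgebra.single w (1 : K) ∈ Hgr K n :=
  Submodule.subset_span ⟨w, hw, rfl⟩

/-- The relation `rel` between words of degree `n` and elements of the algebra contains the graph
of a map `∏ uᵢ vᵢ ↦ ∏ uᵢ gᵢ(vᵢ)` for a subdivision of the word whose blocks `vᵢ` have total
degree `D`. -/
def HasSplitting (n D : ℕ) (rel : FreeMonoid (Fin 6) → FreeA K → Prop) : Prop :=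
  ∃ (s : ℕ) (e d : Fin s → ℕ) (g : Fin s → (FreeA K →ₗ[K] FreeA K)),
    ∑ i, d i = D ∧ ∑ i, (e i + d i) = n ∧
    (∀ i, ∀ a ∈ Hgr K (d i), g i a ∈ Hgr K (d i)) ∧
    ∀ U V : Fin s → FreeMonoid (Fin 6), (∀ i, len (U i) = e i) → (∀ i, len (V i) = d i) →
      rel (List.ofFn fun i => U i * V i).prod
        (List.ofFn fun i =>
          MonoidAlgebra.single (U i) (1 : K) * g i (MonoidAlgebra.single (V i) 1)).prod

namespace HasSplitting

lemma nil {rel : FreeMonoid (Fin 6) → FreeA K → Prop} (h : rel 1 1) : HasSplitting 0 0 rel :=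
  ⟨0, 0, 0, 0, by simp, by simp, fun i => i.elim0, fun U V _ _ => by simpa using h⟩

lemma block {rel : FreeMonoid (Fin 6) → FreeA K → Prop} (e d : ℕ) (g : FreeA K →ₗ[K] FreeA K)
    (hg : ∀ a ∈ Hgr K d, g a ∈ Hgr K d)
    (h : ∀ u v : FreeMonoid (Fin 6), len u = e → len v = d →
      rel (u * v) (MonoidAlgebra.single u (1 : K) * g (MonoidAlgebra.single v 1))) :
    HasSplitting (e + d) d rel :=
  ⟨1, fun _ => e, fun _ => d, fun _ => g, by simp, by simp, fun _ => hg, fun U V hU hV => by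
    simpa using h (U 0) (V 0) (hU 0) (hV 0)⟩

lemma append {rel₁ rel₂ rel : FreeMonoid (Fin 6) → FreeA K → Prop} {n₁ n₂ D₁ D₂ : ℕ}
    (h₁ : HasSplitting n₁ D₁ rel₁) (h₂ : HasSplitting n₂ D₂ rel₂)
    (h : ∀ w₁ w₂ a₁ a₂, rel₁ w₁ a₁ → rel₂ w₂ a₂ → rel (w₁ * w₂) (a₁ * a₂)) :
    HasSplitting (n₁ + n₂) (D₁ + D₂) rel := by
  obtain ⟨s₁, e₁, d₁, g₁, hD₁, hn₁, hg₁, hr₁⟩ := h₁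
  obtain ⟨s₂, e₂, d₂, g₂, hD₂, hn₂, hg₂, hr₂⟩ := h₂
  refine ⟨s₁ + s₂, Fin.append e₁ e₂, Fin.append d₁ d₂, Fin.append g₁ g₂, ?_, ?_, ?_, ?_⟩
  · simp [Fin.sum_univ_add, hD₁, hD₂]
  · simp [Fin.sum_univ_add, ← hn₁, ← hn₂]
  · intro i
    refine Fin.addCases (fun i => ?_) (fun i => ?_) i
    · simpa using hg₁ i
    · simpa using hg₂ i
  · intro U V hU hV
    rw [List.ofFn_add, List.ofFn_add, List.prod_append, List.prod_append]
    have hleft (i : Fin s₁) : Fin.append g₁ g₂ (Fin.castLE (Nat.le_add_right s₁ s₂) i) = g₁ i :=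
      Fin.append_left g₁ g₂ i
    simp only [hleft, Fin.append_right]
    exact h _ _ _ _
      (hr₁ (fun i => U (Fin.castAdd s₂ i)) (fun i => V (Fin.castAdd s₂ i))
        (fun i => by simp [hU]) (fun i => by simp [hV]))
      (hr₂ (fun i => U (Fin.natAdd s₁ i)) (fun i => V (Fin.natAdd s₁ i))
        (fun i => by simp [hU]) (fun i => by simp [hV]))

lemma power {n D : ℕ} {T : FreeA K →ₗ[K] FreeA K}
    (h : HasSplitting n D fun w a => len w = n ∧ T (MonoidAlgebra.single w 1) = a) (N : ℕ) :
    HasSplitting (N * n) (N * D) fun w a => ∃ l : List (FreeMonoid (Fin 6)),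
      l.length = N ∧ (∀ v ∈ l, len v = n) ∧ w = l.prod ∧
        a = (l.map fun v => T (MonoidAlgebra.single v 1)).prod := by
  induction N with
  | zero =>
    rw [Nat.zero_mul, Nat.zero_mul]
    exact nil ⟨[], by simp⟩
  | succ N ih =>
    rw [Nat.succ_mul, Nat.succ_mul, add_comm _ n, add_comm _ D]
    refine append h ih ?_
    rintro w₁ w₂ a₁ a₂ ⟨hw₁, ha₁⟩ ⟨l, hl, hv, rfl, rfl⟩
    exact ⟨w₁ :: l, by simp [hl], by simpa [hw₁] using hv, by simp, by simp [ha₁]⟩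

end HasSplitting

/-- Two linear maps that agree on all `∏ uᵢ vᵢ` and `∏ vᵢ`, with `vᵢ` monomials of degree `dᵢ`,
agree on all `∏ uᵢ aᵢ` and `∏ aᵢ`, with `aᵢ` homogeneous of degree `dᵢ`. -/
lemma linearMap_prod_ofFn_eq {s : ℕ} (U : Fin s → FreeMonoid (Fin 6)) (d : Fin s → ℕ)
    (a : Fin s → FreeA K) (ha : ∀ i, a i ∈ Hgr K (d i)) (P Q : FreeA K →ₗ[K] FreeA K)
    (h : ∀ V : Fin s → FreeMonoid (Fin 6), (∀ i, len (V i) = d i) →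
      P (List.ofFn fun i =>
          MonoidAlgebra.single (U i) (1 : K) * MonoidAlgebra.single (V i) 1).prod =
        Q (List.ofFn fun i => MonoidAlgebra.single (V i) (1 : K)).prod) :
    P (List.ofFn fun i => MonoidAlgebra.single (U i) (1 : K) * a i).prod =
      Q (List.ofFn a).prod := by
  induction s generalizing P Q with
  | zero => simpa using h (fun i => i.elim0) (fun i => i.elim0)
  | succ s ih =>
    have key := ih (fun i => U i.succ) (fun i => d i.succ) (fun i => a i.succ)
      (fun i => ha i.succ)
      (P ∘ₗ LinearMap.mulLeft K (MonoidAlgebra.single (U 0) (1 : K) * a 0))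
      (Q ∘ₗ LinearMap.mulLeft K (a 0)) ?_
    · simpa [List.ofFn_succ, mul_assoc] using key
    · intro V hV
      simp only [LinearMap.comp_apply, LinearMap.mulLeft_apply]
      refine Submodule.span_induction (p := fun b _ =>
        P (MonoidAlgebra.single (U 0) (1 : K) * b * (List.ofFn fun i : Fin s =>
          MonoidAlgebra.single (U i.succ) (1 : K) * MonoidAlgebra.single (V i) 1).prod) =
        Q (b * (List.ofFn fun i => MonoidAlgebra.single (V i) (1 : K)).prod))
        ?_ ?_ ?_ ?_ (ha 0)
      · rintro _ ⟨w, hw, rfl⟩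
        have := h (Fin.cons w V) (fun i => by
          refine Fin.cases ?_ (fun i => ?_) i
          · simpa using hw
          · simpa using hV i)
        simpa only [List.ofFn_succ, List.prod_cons, Fin.cons_zero, Fin.cons_succ] using this
      · simp
      · intro x y _ _ hx hy
        simp only [mul_add, add_mul, map_add, hx, hy]
      · intro r x _ hx
        simp only [mul_smul_comm, smul_mul_assoc, map_smul, hx]

end Splitting

section Unshuffle

variable {α β : Type}

/-- The concatenation of the blocks `uᵢ`, of lengths `eᵢ`, in `u₁ v₁ u₂ v₂ …`, where the blocks
`vᵢ` have lengths `dᵢ`. -/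
def leftBlocks : {s : ℕ} → (Fin s → ℕ) → (Fin s → ℕ) → List α → List α
  | 0, _, _, _ => []
  | _ + 1, e, d, w => w.take (e 0) ++
      leftBlocks (fun i => e i.succ) (fun i => d i.succ) (w.drop (e 0 + d 0))

/-- The concatenation of the blocks `vᵢ`, of lengths `dᵢ`, in `u₁ v₁ u₂ v₂ …`, where the blocks
`uᵢ` have lengths `eᵢ`. -/
def rightBlocks : {s : ℕ} → (Fin s → ℕ) → (Fin s → ℕ) → List α → List α
  | 0, _, _, _ => []
  | _ + 1, e, d, w => (w.drop (e 0)).take (d 0) ++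
      rightBlocks (fun i => e i.succ) (fun i => d i.succ) (w.drop (e 0 + d 0))

lemma map_leftBlocks (f : α → β) {s : ℕ} (e d : Fin s → ℕ) (w : List α) :
    (leftBlocks e d w).map f = leftBlocks e d (w.map f) := by
  induction s generalizing w with
  | zero => rfl
  | succ s ih => simp [leftBlocks, ih, List.map_take, List.map_drop]

lemma map_rightBlocks (f : α → β) {s : ℕ} (e d : Fin s → ℕ) (w : List α) :
    (rightBlocks e d w).map f = rightBlocks e d (w.map f) := by
  induction s generalizing w with
  | zero => rfl
  | succ s ih => simp [rightBlocks, ih, List.map_take, List.map_drop]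

lemma leftBlocks_append_rightBlocks_perm {s : ℕ} (e d : Fin s → ℕ) (w : List α)
    (hw : w.length = ∑ i, (e i + d i)) :
    (leftBlocks e d w ++ rightBlocks e d w).Perm w := by
  induction s generalizing w with
  | zero => simp_all [leftBlocks, rightBlocks]
  | succ s ih =>
    rw [Fin.sum_univ_succ] at hw
    have h := ih (fun i => e i.succ) (fun i => d i.succ) (w.drop (e 0 + d 0)) (by
      rw [List.length_drop, hw, Nat.add_sub_cancel_left])
    have hsplit : w = w.take (e 0) ++ ((w.drop (e 0)).take (d 0) ++ w.drop (e 0 + d 0)) := by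
      rw [← List.drop_drop, List.take_append_drop, List.take_append_drop]
    conv_rhs => rw [hsplit]
    simp only [leftBlocks, rightBlocks, List.append_assoc]
    refine List.Perm.append_left _ ?_
    rw [← List.append_assoc]
    refine (List.perm_append_comm.append_right _).trans ?_
    rw [List.append_assoc]
    exact h.append_left _

lemma leftBlocks_prod {s : ℕ} (e d : Fin s → ℕ) (U V : Fin s → FreeMonoid α)
    (hU : ∀ i, len (U i) = e i) (hV : ∀ i, len (V i) = d i) :
    leftBlocks e d (FreeMonoid.toList (List.ofFn fun i => U i * V i).prod) =
      FreeMonoid.toList (List.ofFn U).prod := by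
  induction s with
  | zero => simp [leftBlocks]
  | succ s ih =>
    have h := ih _ _ (fun i => U i.succ) (fun i => V i.succ) (fun i => hU i.succ)
      (fun i => hV i.succ)
    simp only [leftBlocks, List.ofFn_succ, List.prod_cons, FreeMonoid.toList_mul, ← h]
    rw [← hU 0, ← hV 0]
    congr 1
    · simp [len]
    · rw [List.drop_left' (by simp [len])]

lemma rightBlocks_prod {s : ℕ} (e d : Fin s → ℕ) (U V : Fin s → FreeMonoid α)
    (hU : ∀ i, len (U i) = e i) (hV : ∀ i, len (V i) = d i) :
    rightBlocks e d (FreeMonoid.toList (List.ofFn fun i => U i * V i).prod) =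
      FreeMonoid.toList (List.ofFn V).prod := by
  induction s with
  | zero => simp [rightBlocks]
  | succ s ih =>
    have h := ih _ _ (fun i => U i.succ) (fun i => V i.succ) (fun i => hU i.succ)
      (fun i => hV i.succ)
    simp only [rightBlocks, List.ofFn_succ, List.prod_cons, FreeMonoid.toList_mul, ← h]
    rw [← hU 0, ← hV 0]
    congr 1
    · simp [len]
    · rw [List.drop_left' (by simp [len])]

/-- The position permutation taking `∏ uᵢ vᵢ` to `(∏ uᵢ) (∏ vᵢ)`. -/
lemma exists_perm_map_finRange {s n : ℕ} (e d : Fin s → ℕ) (hn : ∑ i, (e i + d i) = n) :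
    ∃ σ : Equiv.Perm (Fin n), (List.finRange n).map σ =
      leftBlocks e d (List.finRange n) ++ rightBlocks e d (List.finRange n) := by
  have hp := leftBlocks_append_rightBlocks_perm e d (List.finRange n) (by simp [hn])
  set l := leftBlocks e d (List.finRange n) ++ rightBlocks e d (List.finRange n) with hl
  have hlen : l.length = n := by simpa using hp.length_eq
  have hnd : l.Nodup := hp.nodup_iff.2 (List.nodup_finRange n)
  have hinj : Function.Injective fun i : Fin n => l.get (i.cast hlen.symm) := fun i j hij => by
    simpa using hnd.injective_get hij
  refine ⟨Equiv.ofBijective _ (Finite.injective_iff_bijective.1 hinj), ?_⟩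
  refine List.ext_get (by simp [hlen]) fun i h₁ h₂ => ?_
  simp

lemma exists_unshuffle_perm {s n : ℕ} (e d : Fin s → ℕ) (hn : ∑ i, (e i + d i) = n) :
    ∃ σ : Equiv.Perm (Fin n), ∀ U V : Fin s → FreeMonoid (Fin 6),
      (∀ i, len (U i) = e i) → (∀ i, len (V i) = d i) →
      ∃ fn : Fin n → Fin 6, (List.ofFn fun i => U i * V i).prod = wordOfFn fn ∧
        (List.ofFn U).prod * (List.ofFn V).prod = wordOfFn (fn ∘ σ) := by
  obtain ⟨σ, hσ⟩ := exists_perm_map_finRange e d hn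
  refine ⟨σ, fun U V hU hV => ?_⟩
  set w := FreeMonoid.toList (List.ofFn fun i => U i * V i).prod with hw
  have hlen : w.length = n :=
    (len_prod_ofFn _).trans (by simp [len_mul, hU, hV, ← hn])
  have hfn : List.ofFn (fun i : Fin n => w.get (i.cast hlen.symm)) = w := by
    refine List.ext_get (by simp [hlen]) fun i h₁ h₂ => ?_
    simp
  refine ⟨fun i => w.get (i.cast hlen.symm), ?_, ?_⟩
  · rw [wordOfFn, hfn, hw, FreeMonoid.ofList_toList]
  · apply FreeMonoid.toList.injective
    rw [wordOfFn, FreeMonoid.toList_ofList, ← List.map_ofFn, FreeMonoid.toList_mul,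
      ← leftBlocks_prod e d U V hU hV, ← rightBlocks_prod e d U V hU hV, ← hw]
    rw [List.ofFn_eq_map, hσ, List.map_append, map_leftBlocks, map_rightBlocks,
      ← List.ofFn_eq_map, hfn]

end Unshuffle

section Extension

variable (K : Type) [Field K]

/-- The linear map on the free algebra with prescribed values on monomials. -/
noncomputable def ofMonomials (φ : FreeMonoid (Fin 6) → FreeA K) : FreeA K →ₗ[K] FreeA K :=
  Finsupp.linearCombination K φ ∘ₗ (MonoidAlgebra.coeffLinearEquiv K).toLinearMap

variable {K}

lemma ofMonomials_single (φ : FreeMonoid (Fin 6) → FreeA K) (w : FreeMonoid (Fin 6)) :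
    ofMonomials K φ (MonoidAlgebra.single w 1) = φ w := by
  simp [ofMonomials]

lemma exists_permuting_linearMap {n : ℕ} (σ : Equiv.Perm (Fin n)) :
    ∃ P : FreeA K →ₗ[K] FreeA K, ∀ fn : Fin n → Fin 6,
      P (MonoidAlgebra.single (wordOfFn fn) 1) =
        MonoidAlgebra.single (wordOfFn (fn ∘ σ)) 1 := by
  refine ⟨ofMonomials K fun w => MonoidAlgebra.single
    (wordOfFn fun i => (FreeMonoid.toList w).getD (σ i) 0) 1, fun fn => ?_⟩
  rw [ofMonomials_single]
  congr 2
  funext i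
  simp [wordOfFn]

/-- The product of the `gᵢ(vᵢ)` for the consecutive blocks `vᵢ`, of lengths `dᵢ`, of a word. -/
noncomputable def blockwise :
    {s : ℕ} → (Fin s → ℕ) → (Fin s → (FreeA K →ₗ[K] FreeA K)) → List (Fin 6) → FreeA K
  | 0, _, _, _ => 1
  | _ + 1, d, g, w => g 0 (MonoidAlgebra.single (FreeMonoid.ofList (w.take (d 0))) 1) *
      blockwise (fun i => d i.succ) (fun i => g i.succ) (w.drop (d 0))

lemma blockwise_prod {s : ℕ} (d : Fin s → ℕ) (g : Fin s → (FreeA K →ₗ[K] FreeA K))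
    (V : Fin s → FreeMonoid (Fin 6)) (hV : ∀ i, len (V i) = d i) :
    blockwise d g (FreeMonoid.toList (List.ofFn V).prod) =
      (List.ofFn fun i => g i (MonoidAlgebra.single (V i) 1)).prod := by
  induction s with
  | zero => simp [blockwise]
  | succ s ih =>
    have h := ih (fun i => d i.succ) (fun i => g i.succ) (fun i => V i.succ)
      (fun i => hV i.succ)
    simp only [blockwise, List.ofFn_succ, List.prod_cons, FreeMonoid.toList_mul, ← h]
    rw [List.take_left' (hV 0), List.drop_left' (hV 0), FreeMonoid.ofList_toList]

end Extension

section Recursion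

variable {K : Type} [Field K]

lemma HasSplitting.exists_small {m : ℕ → ℕ} (hpos : ∀ i, 0 < m i) (hdvd : ∀ i, m i ∣ m (i + 1))
    (hgrow : ∀ i, 2 ^ (i + 102) * m i < m (i + 1))
    {R c : ℕ → (FreeA K →ₗ[K] FreeA K)}
    (hR0 : ∀ a ∈ Hgr K (m 0), R 0 a = a)
    (hRH : ∀ i, ∀ a ∈ Hgr K (m i), R i a ∈ Hgr K (m i))
    (hcH : ∀ i, ∀ a ∈ Hgr K (m i), c i a ∈ Hgr K (m i))
    (hrec : ∀ (i : ℕ) (l : List (FreeMonoid (Fin 6))),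
      l.length = m (i + 1) / m i → (∀ w ∈ l, len w = m i) →
      R (i + 1) (MonoidAlgebra.single l.prod 1) =
        c i (R i (MonoidAlgebra.single l.headI 1)) *
          (l.tail.map fun w => R i (MonoidAlgebra.single w 1)).prod) (k : ℕ) :
    ∃ D, D * 2 ^ (k + 101) + m k ≤ 2 ^ k * m k ∧
      HasSplitting (m k) D fun w a => len w = m k ∧ R k (MonoidAlgebra.single w 1) = a := by
  induction k with
  | zero =>
    refine ⟨0, by simp, HasSplitting.block (m 0) 0 LinearMap.id (fun _ h => h) ?_⟩
    intro u v hu hv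
    have hlen : len (u * v) = m 0 := by rw [len_mul, hu, hv, add_zero]
    exact ⟨hlen, by simp [hR0 _ (single_mem_Hgr hlen), MonoidAlgebra.single_mul_single]⟩
  | succ k ih =>
    obtain ⟨D, hD, hS⟩ := ih
    obtain ⟨N, hN⟩ := hdvd k
    have hdiv : m (k + 1) / m k = N := by rw [hN, Nat.mul_div_cancel_left _ (hpos k)]
    have hlarge : 2 ^ (k + 102) < N := by
      have := hgrow k
      rw [hN, mul_comm (m k)] at this
      exact lt_of_mul_lt_mul_right this (Nat.zero_le _)
    obtain ⟨N, rfl⟩ : ∃ M, N = M + 1 :=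
      Nat.exists_eq_succ_of_ne_zero (Nat.ne_zero_of_lt hlarge)
    refine ⟨m k + N * D, ?_, ?_⟩
    · rw [hN]
      have h₁ : 2 ^ (k + 102) * m k ≤ (N + 1) * m k := Nat.mul_le_mul_right _ hlarge.le
      have h₂ := Nat.mul_le_mul_left (2 * (N + 1)) hD
      have h₃ : 2 ^ (k + 102) = 2 * 2 ^ (k + 101) := pow_succ' 2 (k + 101)
      have h₄ : 2 ^ (k + 1) = 2 * 2 ^ k := pow_succ' 2 k
      rw [show k + 1 + 101 = k + 102 from by ring, h₄]
      rw [h₃] at h₁ ⊢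
      nlinarith [Nat.zero_le (D * 2 ^ (k + 101))]
    · have hfirst : HasSplitting (K := K) (0 + m k) (m k) fun w a =>
          len w = m k ∧ c k (R k (MonoidAlgebra.single w 1)) = a := by
        refine HasSplitting.block 0 (m k) (c k ∘ₗ R k)
          (fun a ha => hcH k _ (hRH k a ha)) fun u v hu hv => ?_
        obtain rfl : u = 1 := FreeMonoid.toList.injective (List.length_eq_zero_iff.1 hu)
        exact ⟨by simpa using hv, by
          simp [← MonoidAlgebra.one_def]⟩
      rw [show m (k + 1) = 0 + m k + N * m k by rw [hN]; ring]
      refine hfirst.append (hS.power N) ?_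
      rintro w₁ w₂ a₁ a₂ ⟨hw₁, rfl⟩ ⟨l, hl, hv, rfl, rfl⟩
      refine ⟨?_, ?_⟩
      · clear hrec hdiv
        rw [len_mul, hw₁, zero_add, ← hl]
        congr 1
        clear hl
        induction l with
        | nil => simp [len]
        | cons v l ih =>
          rw [List.prod_cons, len_mul, hv v (by simp),
            ih fun x hx => hv x (List.mem_cons_of_mem _ hx), List.length_cons]
          ring
      · have := hrec k (w₁ :: l) (by rw [hdiv, List.length_cons, hl]) (by
          simpa [hw₁] using hv)
        simpa using this

end Recursion

theorem stmt10 (K : Type) [Field K] (m : ℕ → ℕ)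
    (hmono : StrictMono m) (hm1 : 10 ^ 8 < m 0)
    (hdvd : ∀ i, 40 * m i ∣ m (i + 1)) (hgrow : ∀ i, 2 ^ (i + 102) * m i < m (i + 1))
    (F : ℕ → Finset (FreeA K)) (hF : ∀ i, (F i : Set (FreeA K)) ⊆ (Hgr K (m i) : Set (FreeA K)))
    (R c : ℕ → (FreeA K →ₗ[K] FreeA K))
    (hR0 : ∀ a ∈ Hgr K (m 0), R 0 a = a)
    (hRH : ∀ i, ∀ a ∈ Hgr K (m i), R i a ∈ Hgr K (m i))
    (hcH : ∀ i, ∀ a ∈ Hgr K (m i), c i a ∈ Hgr K (m i))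
    (hcker : ∀ i, ∀ a ∈ Hgr K (m i),
      (c i a = 0 ↔ a ∈ Submodule.span K (⇑(R i) '' (F i : Set (FreeA K)))))
    (hrec : ∀ (i : ℕ) (l : List (FreeMonoid (Fin 6))),
      l.length = m (i + 1) / m i → (∀ w ∈ l, len w = m i) →
      R (i + 1) (MonoidAlgebra.single l.prod 1) =
        c i (R i (MonoidAlgebra.single l.headI 1)) *
          (l.tail.map fun w => R i (MonoidAlgebra.single w 1)).prod) :
    ∀ k : ℕ, ∃ (s : ℕ) (e d : Fin s → ℕ),
      50 * (∑ i, d i) < (∑ i, e i) ∧ (∑ i, (e i + d i)) = m k ∧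
      ∃ g : Fin s → (FreeA K →ₗ[K] FreeA K),
        (∀ i, ∀ a ∈ Hgr K (d i), g i a ∈ Hgr K (d i)) ∧
        (∀ U V : Fin s → FreeMonoid (Fin 6),
          (∀ i, len (U i) = e i) → (∀ i, len (V i) = d i) →
          R k (MonoidAlgebra.single (List.ofFn fun i => U i * V i).prod 1) =
            (List.ofFn fun i =>
              MonoidAlgebra.single (U i) (1 : K) * g i (MonoidAlgebra.single (V i) 1)).prod) ∧
        ∃ (σ : Equiv.Perm (Fin (m k))) (Pσ Pτ fk : FreeA K →ₗ[K] FreeA K),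
          (∀ fn : Fin (m k) → Fin 6,
            Pσ (MonoidAlgebra.single (wordOfFn fn) 1) =
              MonoidAlgebra.single (wordOfFn (fn ∘ σ)) 1) ∧
          (∀ fn : Fin (m k) → Fin 6,
            Pτ (MonoidAlgebra.single (wordOfFn fn) 1) =
              MonoidAlgebra.single (wordOfFn (fn ∘ σ.symm)) 1) ∧
          (∀ U V : Fin s → FreeMonoid (Fin 6),
            (∀ i, len (U i) = e i) → (∀ i, len (V i) = d i) →
            Pσ (MonoidAlgebra.single (List.ofFn fun i => U i * V i).prod 1) =
              MonoidAlgebra.single ((List.ofFn U).prod * (List.ofFn V).prod) 1) ∧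
          (∀ V : Fin s → FreeMonoid (Fin 6), (∀ i, len (V i) = d i) →
            fk (MonoidAlgebra.single (List.ofFn V).prod 1) =
              (List.ofFn fun i => g i (MonoidAlgebra.single (V i) 1)).prod) ∧
          (∀ U V : Fin s → FreeMonoid (Fin 6),
            (∀ i, len (U i) = e i) → (∀ i, len (V i) = d i) →
            Pσ (R k (Pτ (MonoidAlgebra.single ((List.ofFn U).prod * (List.ofFn V).prod) 1))) =
              MonoidAlgebra.single (List.ofFn U).prod (1 : K) *
                fk (MonoidAlgebra.single (List.ofFn V).prod 1)) := by
  intro k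
  have hpos : ∀ i, 0 < m i := fun i =>
    (Nat.zero_lt_of_lt hm1).trans_le (hmono.monotone (Nat.zero_le i))
  obtain ⟨D, hD, s, e, d, g, hd, hn, hg, hR⟩ := HasSplitting.exists_small hpos
    (fun i => (Dvd.intro_left 40 rfl).trans (hdvd i)) hgrow hR0 hRH hcH hrec k
  obtain ⟨σ, hσ⟩ := exists_unshuffle_perm e d hn
  obtain ⟨Pσ, hPσ⟩ := exists_permuting_linearMap (K := K) σ
  obtain ⟨Pτ, hPτ⟩ := exists_permuting_linearMap (K := K) σ.symm
  have hfk (V : Fin s → FreeMonoid (Fin 6)) (hV : ∀ i, len (V i) = d i) :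
      ofMonomials K (fun w => blockwise d g (FreeMonoid.toList w))
          (MonoidAlgebra.single (List.ofFn V).prod 1) =
        (List.ofFn fun i => g i (MonoidAlgebra.single (V i) 1)).prod := by
    rw [ofMonomials_single, blockwise_prod d g V hV]
  have hunshuffle (U V : Fin s → FreeMonoid (Fin 6)) (hU : ∀ i, len (U i) = e i)
      (hV : ∀ i, len (V i) = d i) :
      Pσ (MonoidAlgebra.single (List.ofFn fun i => U i * V i).prod 1) =
        MonoidAlgebra.single ((List.ofFn U).prod * (List.ofFn V).prod) 1 := by
    obtain ⟨fn, h₁, h₂⟩ := hσ U V hU hV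
    rw [h₁, h₂, hPσ]
  refine ⟨s, e, d, ?_, hn, g, hg, fun U V hU hV => (hR U V hU hV).2, σ, Pσ, Pτ, _, hPσ, hPτ,
    hunshuffle, hfk, fun U V hU hV => ?_⟩
  · rw [Finset.sum_add_distrib, hd] at hn
    have hlt : D * 2 ^ 101 < m k := by
      refine lt_of_mul_lt_mul_left (a := 2 ^ k) ?_ (Nat.zero_le _)
      rw [pow_add] at hD
      have := hpos k
      linarith
    omega
  · have hprod {t : ℕ} (w : Fin t → FreeMonoid (Fin 6)) :
        (List.ofFn fun i => MonoidAlgebra.single (w i) (1 : K)).prod =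
          MonoidAlgebra.single (List.ofFn w).prod 1 := by
      simpa [List.map_ofFn, Function.comp_def] using
        (map_list_prod (MonoidAlgebra.of K (FreeMonoid (Fin 6))) (List.ofFn w)).symm
    obtain ⟨fn, h₁, h₂⟩ := hσ U V hU hV
    have hinv : (fn ∘ σ) ∘ σ.symm = fn := by
      funext i
      simp
    rw [hfk V hV, h₂, hPτ, hinv, ← h₁, (hR U V hU hV).2]
    refine linearMap_prod_ofFn_eq U d _ (fun i => hg i _ (single_mem_Hgr (hV i))) Pσ
      (LinearMap.mulLeft K (MonoidAlgebra.single (List.ofFn U).prod 1)) fun W hW => ?_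
    simp only [MonoidAlgebra.single_mul_single, mul_one, hprod, LinearMap.mulLeft_apply]
    exact hunshuffle U W hU hW
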